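/- arXiv:math/0702787 — 2 statements merged into one kernel-verified Lean document; each statement's English description precedes it below -/
import Mathlib

section
/- Let m > 0, ρ > 0 and ν ∈ ℝ. Let q_e, p_e : ℝ → ℝ be differentiable functions satisfying the linear system q̇_e(t) = (1/m) p_e(t) − (ν²ρ/(2m)) q_e(t) and ṗ_e(t) = −(ν²ρ/(2m)) p_e(t) − ρ q_e(t) for all t. Then q_e is twice differentiable and satisfies the damped harmonic oscillator equation m q̈_e(t) = −ν²ρ q̇_e(t) − ρ (ν⁴ρ/(4m) + 1) q_e(t) for all t. -/
/-- **The averaged damped harmonic oscillator.** Let `m > 0`, `ρ > 0`, `ν ∈ ℝ` and let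
`q_e, p_e : ℝ → ℝ` be differentiable functions satisfying
`q̇_e = (1/m) p_e − (ν²ρ/(2m)) q_e` and `ṗ_e = −(ν²ρ/(2m)) p_e − ρ q_e`.
Then `q_e` is twice differentiable and `m q̈_e = −ν²ρ q̇_e − ρ(ν⁴ρ/(4m) + 1) q_e`. -/
theorem stmt_5 (m ρ ν : ℝ) (hm : 0 < m) (hρ : 0 < ρ)
    (qe pe : ℝ → ℝ) (hqe : Differentiable ℝ qe) (hpe : Differentiable ℝ pe)
    (h1 : ∀ t : ℝ, deriv qe t = (1 / m) * pe t - (ν ^ 2 * ρ / (2 * m)) * qe t)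
    (h2 : ∀ t : ℝ, deriv pe t = -(ν ^ 2 * ρ / (2 * m)) * pe t - ρ * qe t) :
    Differentiable ℝ (deriv qe) ∧
      ∀ t : ℝ, m * deriv (deriv qe) t =
        -(ν ^ 2 * ρ) * deriv qe t - ρ * (ν ^ 4 * ρ / (4 * m) + 1) * qe t := by
  have hd : ∀ t, HasDerivAt (deriv qe)
      ((1 / m) * deriv pe t - (ν ^ 2 * ρ / (2 * m)) * deriv qe t) t := by
    intro t
    have h := ((hpe t).hasDerivAt.const_mul (1 / m)).sub
      ((hqe t).hasDerivAt.const_mul (ν ^ 2 * ρ / (2 * m)))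
    exact h.congr_of_eventuallyEq (Filter.Eventually.of_forall h1)
  refine ⟨fun t => (hd t).differentiableAt, fun t => ?_⟩
  rw [(hd t).deriv, h2, h1]
  have hm' : m ≠ 0 := hm.ne'
  field_simp
  ring
end

section
/- Let M be a topological space, K ⊆ M a compact set, z an element of the interior of K, and f : M → ℝ a continuous function such that f(z) < inf{ f(y) : y ∈ ∂K }, where ∂K denotes the topological boundary of K. Let Γ : [0,∞) × Ω → M be a stochastic process with continuous paths on a probability space (Ω, 𝓕, P) such that Γ_0 = z almost surely and such that almost surely f(Γ_t) = f(Γ_0) for all t ∈ [0,∞). Then almost surely Γ_t ∈ K for all t ∈ [0,∞). -/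
open MeasureTheory

/-- **Almost sure stability from a strongly conserved quantity.** Let `K ⊆ M` be
compact, `z` a point in the interior of `K`, and `f : M → ℝ` continuous with
`f(z) < inf{f(y) : y ∈ ∂K}`. If `Γ` is a process with continuous paths such that
`Γ₀ = z` a.s. and `f(Γ_t) = f(Γ₀)` for all `t ≥ 0` a.s. (strong conservation),
then a.s. `Γ_t ∈ K` for all `t ≥ 0`. -/
theorem stmt_8 {M : Type*} [TopologicalSpace M]
    {Ω : Type*} [MeasurableSpace Ω] (P : Measure Ω) [IsProbabilityMeasure P]
    (K : Set M) (hK : IsCompact K) (z : M) (hz : z ∈ interior K)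
    (f : M → ℝ) (hf : Continuous f)
    (hfz : f z < sInf (f '' frontier K))
    (Γ : ℝ → Ω → M)
    (hΓcont : ∀ ω, Continuous fun t => Γ t ω)
    (hΓ0 : ∀ᵐ ω ∂P, Γ 0 ω = z)
    (hcons : ∀ᵐ ω ∂P, ∀ t : ℝ, 0 ≤ t → f (Γ t ω) = f (Γ 0 ω)) :
    ∀ᵐ ω ∂P, ∀ t : ℝ, 0 ≤ t → Γ t ω ∈ K := by
  have hbdd : BddBelow (f '' frontier K) := by
    have h1 : f '' frontier K ⊆ f '' K := by
      calc f '' frontier K ⊆ f '' closure K := Set.image_mono frontier_subset_closure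
        _ ⊆ closure (f '' K) := image_closure_subset_closure_image hf
        _ = f '' K := (hK.image hf).isClosed.closure_eq
    exact (hK.image hf).bddBelow.mono h1
  filter_upwards [hΓ0, hcons] with ω h0 hc t ht
  by_contra hn
  have hpre : IsPreconnected ((fun t => Γ t ω) '' Set.Ici 0) :=
    isPreconnected_Ici.image _ (hΓcont ω).continuousOn
  have hne : ∀ s : ℝ, 0 ≤ s → Γ s ω ∉ frontier K := by
    intro s hs hmem
    have h1 := csInf_le hbdd (Set.mem_image_of_mem f hmem)
    rw [hc s hs, h0] at h1
    linarith
  have hcl : Γ t ω ∉ closure K := by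
    intro h
    exact hne t ht ⟨h, fun h' => hn (interior_subset h')⟩
  obtain ⟨y, ⟨s, hs, rfl⟩, hy1, hy2⟩ := hpre (interior K) (closure K)ᶜ isOpen_interior
    isClosed_closure.isOpen_compl
    (by
      rintro _ ⟨s, hs, rfl⟩
      by_cases hi : Γ s ω ∈ interior K
      · exact Or.inl hi
      · exact Or.inr fun h => hne s hs ⟨h, hi⟩)
    ⟨z, ⟨0, le_refl (0 : ℝ), h0⟩, hz⟩ ⟨Γ t ω, ⟨t, ht, rfl⟩, hcl⟩
  exact hy2 (subset_closure (interior_subset hy1))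
end
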